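/- arXiv:1809.03678 — 3 statements merged into one kernel-verified Lean document; each statement's English description precedes it below -/
import Mathlib

section
/- Let (Γ,α) be an orbifold torus graph admitting a connection, and assume every pair of faces has a minimal face containing both. Then μ induces a ring isomorphism between ℚ[x_F | F ∈ 𝓕]/ℐ_ℚ and the rational equivariant cohomology H*_T(Γ,α;ℚ), where ℐ_ℚ is the ideal of ℚ[x_F | F ∈ 𝓕] generated by the elements x_E x_F − x_{E∨F}·Σ_G x_G (G running over the connected components of E∩F). In particular, μ maps ℚ[x_F | F ∈ 𝓕] onto H*_T(Γ,α;ℚ) with kernel ℐ_ℚ. -/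
open scoped Classical

noncomputable section

/-- A finite graph with oriented edges: orientation reversal `bar`, initial vertex `src`
(denoted `i(e)` in the paper) and terminal vertex `dst` (denoted `t(e)`). -/
structure OTGraph (V E : Type) where
  bar : E → E
  src : E → V
  dst : E → V
  bar_bar : ∀ e, bar (bar e) = e
  src_bar : ∀ e, src (bar e) = dst e
  dst_bar : ∀ e, dst (bar e) = src e

namespace OT

variable {V E : Type}

/-- The graph is `n`-valent: every vertex has exactly `n` outgoing edges. -/
def IsValent (G : OTGraph V E) (n : ℕ) : Prop :=
  ∀ v : V, Nat.card {e : E // G.src e = v} = n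

/-- A rational vector has integer entries. -/
def IsIntVec {n : ℕ} (a : Fin n → ℚ) : Prop := ∀ j, ∃ z : ℤ, a j = (z : ℚ)

/-- The axial-function conditions for an orbifold torus graph / orbifold GKM-graph:
(1) the vectors attached to the outgoing edges at each vertex are linearly independent;
(2) for each edge `e` there are positive integers `r_e`, `r_ē` with
`r_e • α e = ± r_ē • α (ē)` an integer vector. -/
def IsAxial {n : ℕ} (G : OTGraph V E) (α : E → Fin n → ℚ) : Prop :=
  (∀ p : V, LinearIndependent ℚ (fun e : {e : E // G.src e = p} => α e.1)) ∧
  (∀ e : E, ∃ r r' : ℕ, 0 < r ∧ 0 < r' ∧ IsIntVec ((r : ℚ) • α e) ∧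
    ((r : ℚ) • α e = (r' : ℚ) • α (G.bar e) ∨ (r : ℚ) • α e = -((r' : ℚ) • α (G.bar e))))

/-- `r̃_e` : the smallest positive integer `m` with `m • α e ∈ ℤ^n`. -/
def rtil {n : ℕ} (α : E → Fin n → ℚ) (e : E) : ℕ :=
  sInf {m : ℕ | 0 < m ∧ IsIntVec ((m : ℚ) • α e)}

/-- A connection on an (orbifold) torus graph: for each oriented edge `e`, a bijection
`θ e` from the outgoing edges at `i(e)` to the outgoing edges at `t(e)` with `θ e e = ē`,
such that for each outgoing edge `e'` at `i(e)` there is a nonzero integer `c` with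
`c • (α (θ e e') - α e')` an integer multiple of `r̃_e • α e`. -/
def IsConnection {n : ℕ} (G : OTGraph V E) (α : E → Fin n → ℚ) (θ : E → E → E) : Prop :=
  (∀ e : E, Set.BijOn (θ e) {e' | G.src e' = G.src e} {e' | G.src e' = G.dst e}) ∧
  (∀ e : E, θ e e = G.bar e) ∧
  (∀ e e' : E, G.src e' = G.src e →
    ∃ c : ℤ, c ≠ 0 ∧ ∃ z : ℤ,
      (c : ℚ) • (α (θ e e') - α e') = ((z * (rtil α e : ℤ) : ℤ) : ℚ) • α e)

/-- A subgraph: a set of vertices together with a set of oriented edges. -/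
structure Subgr (V E : Type) where
  verts : Set V
  edges : Set E

/-- Containment of subgraphs. -/
def Subgr.le (A B : Subgr V E) : Prop := A.verts ⊆ B.verts ∧ A.edges ⊆ B.edges

/-- Reachability inside a subgraph. -/
def Reach (G : OTGraph V E) (S : Subgr V E) : V → V → Prop :=
  Relation.ReflTransGen (fun u w => ∃ e ∈ S.edges, G.src e = u ∧ G.dst e = w)

/-- A face of the (orbifold) torus graph: a nonempty connected `d`-valent subgraph, closed
under orientation reversal, which is invariant under the connection `θ`. -/
def IsFace (G : OTGraph V E) (θ : E → E → E) (S : Subgr V E) : Prop :=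
  S.verts.Nonempty ∧
  (∀ e ∈ S.edges, G.src e ∈ S.verts ∧ G.dst e ∈ S.verts) ∧
  (∀ e ∈ S.edges, G.bar e ∈ S.edges) ∧
  (∃ d : ℕ, ∀ v ∈ S.verts, Nat.card {e : E // e ∈ S.edges ∧ G.src e = v} = d) ∧
  (∀ u ∈ S.verts, ∀ w ∈ S.verts, Reach G S u w) ∧
  (∀ e ∈ S.edges, ∀ e', G.src e' = G.src e → e' ∈ S.edges → θ e e' ∈ S.edges)

/-- Proper faces: faces other than the whole graph `Γ`.  These index the generators
`x_F` of the (weighted) face ring; the convention `x_Γ = 1` is built into `xpoly`. -/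
def PFace (G : OTGraph V E) (θ : E → E → E) : Type :=
  {S : Subgr V E // IsFace G θ S ∧ S.edges ≠ Set.univ}

/-- The generator `x_F` attached to a subgraph: `x_Γ = 1`, `x_F = X F` for a proper face,
and `0` if `F` is not a face (the convention `x_∅ = 0`). -/
def xpoly (G : OTGraph V E) (θ : E → E → E) (S : Subgr V E) :
    MvPolynomial (PFace G θ) ℚ :=
  if h : IsFace G θ S then
    (if htop : S.edges = Set.univ then 1 else MvPolynomial.X (⟨S, h, htop⟩ : PFace G θ))
  else 0

/-- The linear form in `ℚ[t_1,…,t_n]` associated to a vector `a ∈ ℚ^n`. -/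
def linf {n : ℕ} (a : Fin n → ℚ) : MvPolynomial (Fin n) ℚ :=
  ∑ j, MvPolynomial.C (a j) * MvPolynomial.X j

/-- The rational Thom class `τ_F` of a subgraph `F`. -/
def tau {n : ℕ} (G : OTGraph V E) (α : E → Fin n → ℚ) (S : Subgr V E) (v : V) :
    MvPolynomial (Fin n) ℚ :=
  if v ∈ S.verts then ∏ᶠ (e : E) (_ : G.src e = v ∧ e ∉ S.edges), linf (α e) else 0

/-- The ring homomorphism `μ : ℚ[x_F | F ∈ 𝓕] → Maps(V(Γ), ℚ[t_1,…,t_n])`, `x_F ↦ τ_F`. -/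
def mu {n : ℕ} (G : OTGraph V E) (α : E → Fin n → ℚ) (θ : E → E → E) :
    MvPolynomial (PFace G θ) ℚ →+* (V → MvPolynomial (Fin n) ℚ) :=
  MvPolynomial.eval₂Hom ((Pi.constRingHom V (MvPolynomial (Fin n) ℚ)).comp MvPolynomial.C)
    (fun F => tau G α F.1)

/-- A polynomial with rational coefficients has integer coefficients. -/
def IsIntPoly {σ : Type} (p : MvPolynomial σ ℚ) : Prop :=
  ∀ m : σ →₀ ℕ, ∃ z : ℤ, MvPolynomial.coeff m p = (z : ℚ)

/-- `𝒵_{Γ,α}`: integer-coefficient polynomials in the `x_F` all of whose `μ`-values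
at vertices are integer-coefficient polynomials. -/
def Zset {n : ℕ} (G : OTGraph V E) (α : E → Fin n → ℚ) (θ : E → E → E) :
    Set (MvPolynomial (PFace G θ) ℚ) :=
  {f | IsIntPoly f ∧ ∀ v : V, IsIntPoly (mu G α θ f v)}

/-- The integral equivariant cohomology `H^*_T(Γ,α)` of the graph. -/
def HintSet {n : ℕ} (G : OTGraph V E) (α : E → Fin n → ℚ) :
    Set (V → MvPolynomial (Fin n) ℚ) :=
  {f | (∀ v, IsIntPoly (f v)) ∧
    ∀ e : E, ∃ g : MvPolynomial (Fin n) ℚ, IsIntPoly g ∧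
      f (G.src e) - f (G.dst e) = linf ((rtil α e : ℚ) • α e) * g}

/-- The rational equivariant cohomology `H^*_T(Γ,α;ℚ)` of the graph. -/
def HQSet {n : ℕ} (G : OTGraph V E) (α : E → Fin n → ℚ) :
    Set (V → MvPolynomial (Fin n) ℚ) :=
  {f | ∀ e : E, linf (α e) ∣ (f (G.src e) - f (G.dst e))}

/-- Intersection of subgraphs. -/
def Subgr.inter (A B : Subgr V E) : Subgr V E := ⟨A.verts ∩ B.verts, A.edges ∩ B.edges⟩

/-- `C` is a connected component of the subgraph `S`. -/
def IsCompOf (G : OTGraph V E) (C S : Subgr V E) : Prop :=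
  ∃ v₀ ∈ S.verts, C.verts = {w ∈ S.verts | Reach G S v₀ w} ∧
    C.edges = {e ∈ S.edges | G.src e ∈ C.verts ∧ G.dst e ∈ C.verts}

/-- The relation `x_A x_B − x_{A∨B} Σ_C x_C`, the sum over connected components of `A ∩ B`. -/
def relPoly (G : OTGraph V E) (θ : E → E → E)
    (join : Subgr V E → Subgr V E → Subgr V E) (A B : Subgr V E) :
    MvPolynomial (PFace G θ) ℚ :=
  xpoly G θ A * xpoly G θ B -
    xpoly G θ (join A B) *
      ∑ᶠ (C : Subgr V E) (_ : IsCompOf G C (Subgr.inter A B)), xpoly G θ C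

/-- The set of all relations `x_A x_B − x_{A∨B} Σ_C x_C`, over pairs of faces `A`,`B`. -/
def relSet (G : OTGraph V E) (θ : E → E → E)
    (join : Subgr V E → Subgr V E → Subgr V E) :
    Set (MvPolynomial (PFace G θ) ℚ) :=
  {p | ∃ A B : Subgr V E, IsFace G θ A ∧ IsFace G θ B ∧ p = relPoly G θ join A B}

/-- Membership in the ideal `ℐ` of `𝒵_{Γ,α}` generated by the relations. -/
def memI {n : ℕ} (G : OTGraph V E) (α : E → Fin n → ℚ) (θ : E → E → E)
    (join : Subgr V E → Subgr V E → Subgr V E)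
    (f : MvPolynomial (PFace G θ) ℚ) : Prop :=
  ∃ (k : ℕ) (g r : Fin k → MvPolynomial (PFace G θ) ℚ),
    (∀ i, g i ∈ Zset G α θ ∧ r i ∈ relSet G θ join) ∧ f = ∑ i, g i * r i

/-- `join` assigns to every pair of faces a minimal face containing both. -/
def IsJoinFun (G : OTGraph V E) (θ : E → E → E)
    (join : Subgr V E → Subgr V E → Subgr V E) : Prop :=
  ∀ A B : Subgr V E, IsFace G θ A → IsFace G θ B →
    IsFace G θ (join A B) ∧ Subgr.le A (join A B) ∧ Subgr.le B (join A B) ∧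
    ∀ C : Subgr V E, IsFace G θ C → Subgr.le A C → Subgr.le B C → Subgr.le (join A B) C

end OT

namespace OT

section Faces

variable {V E : Type} {n : ℕ} {G : OTGraph V E} {α : E → Fin n → ℚ} {θ : E → E → E}

lemma IsAxial.bar_eq_smul (hax : IsAxial G α) (e : E) :
    ∃ q : ℚ, α (G.bar e) = q • α e := by
  obtain ⟨r, r', hr, hr', -, h⟩ := hax.2 e
  have hr0 : (r' : ℚ) ≠ 0 := by positivity
  rcases h with h | h
  · refine ⟨(r' : ℚ)⁻¹ * r, ?_⟩
    rw [mul_smul, h, smul_smul, inv_mul_cancel₀ hr0, one_smul]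
  · refine ⟨-((r' : ℚ)⁻¹ * r), ?_⟩
    rw [neg_smul, mul_smul, h, smul_neg, neg_neg, smul_smul, inv_mul_cancel₀ hr0, one_smul]

lemma IsAxial.bar_mem_iff (hax : IsAxial G α) (W : Submodule ℚ (Fin n → ℚ)) (e : E) :
    α (G.bar e) ∈ W ↔ α e ∈ W := by
  constructor
  · intro h
    obtain ⟨q, hq⟩ := hax.bar_eq_smul (G.bar e)
    rw [G.bar_bar] at hq
    rw [hq]
    exact W.smul_mem _ h
  · intro h
    obtain ⟨q, hq⟩ := hax.bar_eq_smul e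
    rw [hq]
    exact W.smul_mem _ h

lemma IsConnection.eq_add_smul (hθ : IsConnection G α θ) {e e' : E} (h : G.src e' = G.src e) :
    ∃ q : ℚ, α (θ e e') = α e' + q • α e := by
  obtain ⟨c, hc, z, hz⟩ := hθ.2.2 e e' h
  have hc0 : (c : ℚ) ≠ 0 := by exact_mod_cast hc
  refine ⟨(c : ℚ)⁻¹ * ((z * (rtil α e : ℤ) : ℤ) : ℚ), ?_⟩
  rw [mul_smul, ← hz, smul_smul, inv_mul_cancel₀ hc0, one_smul]
  abel

lemma IsConnection.src_eq (hθ : IsConnection G α θ) {e e' : E} (h : G.src e' = G.src e) :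
    G.src (θ e e') = G.dst e :=
  (hθ.1 e).mapsTo h

lemma IsConnection.mem_iff (hθ : IsConnection G α θ) {W : Submodule ℚ (Fin n → ℚ)} {e e' : E}
    (he : α e ∈ W) (h : G.src e' = G.src e) : α (θ e e') ∈ W ↔ α e' ∈ W := by
  obtain ⟨q, hq⟩ := hθ.eq_add_smul h
  rw [hq]
  exact Submodule.add_mem_iff_left _ (W.smul_mem _ he)

/-- The span of the labels of the edges in `S` that start at `v`. -/
def localSpan (G : OTGraph V E) (α : E → Fin n → ℚ) (S : Set E) (v : V) :
    Submodule ℚ (Fin n → ℚ) :=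
  Submodule.span ℚ (α '' {e | G.src e = v ∧ e ∈ S})

lemma mem_localSpan {S : Set E} {e : E} (he : e ∈ S) : α e ∈ localSpan G α S (G.src e) :=
  Submodule.subset_span ⟨e, ⟨rfl, he⟩, rfl⟩

lemma IsAxial.mem_localSpan_iff (hax : IsAxial G α) {S : Set E} {v : V} {e : E}
    (hv : G.src e = v) : α e ∈ localSpan G α S v ↔ e ∈ S := by
  constructor
  · intro h
    by_contra hS
    refine (hax.1 v).notMem_span_image (s := {e' | e'.1 ∈ S}) (x := ⟨e, hv⟩) hS ?_
    refine Submodule.span_mono ?_ h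
    rintro _ ⟨e', ⟨h1, h2⟩, rfl⟩
    exact ⟨⟨e', h1⟩, h2, rfl⟩
  · rintro h
    subst hv
    exact mem_localSpan h

/-- Transport along an edge of a connection-invariant set of edges can only increase the span. -/
lemma localSpan_le (hax : IsAxial G α) (hθ : IsConnection G α θ) {S : Set E}
    {e : E} (hbar : G.bar e ∈ S)
    (hS : ∀ e', G.src e' = G.src e → e' ∈ S → θ e e' ∈ S) :
    localSpan G α S (G.src e) ≤ localSpan G α S (G.dst e) := by
  refine Submodule.span_le.2 ?_
  rintro _ ⟨e', ⟨h1, h2⟩, rfl⟩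
  have hb : α e ∈ localSpan G α S (G.dst e) := by
    rw [← hax.bar_mem_iff, ← G.src_bar]
    exact mem_localSpan hbar
  refine (hθ.mem_iff hb h1).1 ?_
  rw [← hθ.src_eq h1]
  exact mem_localSpan (hS e' h1 h2)

lemma IsFace.src_mem {S : Subgr V E} (hS : IsFace G θ S) {e : E} (he : e ∈ S.edges) :
    G.src e ∈ S.verts := (hS.2.1 e he).1

lemma IsFace.dst_mem {S : Subgr V E} (hS : IsFace G θ S) {e : E} (he : e ∈ S.edges) :
    G.dst e ∈ S.verts := (hS.2.1 e he).2

lemma IsFace.bar_mem {S : Subgr V E} (hS : IsFace G θ S) {e : E} (he : e ∈ S.edges) :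
    G.bar e ∈ S.edges := hS.2.2.1 e he

lemma IsFace.bar_mem_iff {S : Subgr V E} (hS : IsFace G θ S) {e : E} :
    G.bar e ∈ S.edges ↔ e ∈ S.edges :=
  ⟨fun h => by simpa [G.bar_bar] using hS.bar_mem h, hS.bar_mem⟩

lemma IsFace.map_mem {S : Subgr V E} (hS : IsFace G θ S) {e e' : E} (he : e ∈ S.edges)
    (h : G.src e' = G.src e) (he' : e' ∈ S.edges) : θ e e' ∈ S.edges :=
  hS.2.2.2.2.2 e he e' h he'

lemma IsFace.reach {S : Subgr V E} (hS : IsFace G θ S) {v w : V} (hv : v ∈ S.verts)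
    (hw : w ∈ S.verts) : Reach G S v w :=
  hS.2.2.2.2.1 v hv w hw

/-- Propagate a property along the edges of a face. -/
lemma IsFace.induction_on {S : Subgr V E} (hS : IsFace G θ S) {P : V → Prop} {v w : V}
    (hv : v ∈ S.verts) (hw : w ∈ S.verts) (h0 : P v)
    (h1 : ∀ e ∈ S.edges, P (G.src e) → P (G.dst e)) : P w := by
  have h := hS.reach hv hw
  unfold Reach at h
  clear hw
  induction h with
  | refl => exact h0
  | tail _ h ih =>
    obtain ⟨e, he, rfl, rfl⟩ := h
    exact h1 e he ih

lemma IsFace.localSpan_eq (hax : IsAxial G α) (hθ : IsConnection G α θ) {S : Subgr V E}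
    (hS : IsFace G θ S) {v w : V} (hv : v ∈ S.verts) (hw : w ∈ S.verts) :
    localSpan G α S.edges w = localSpan G α S.edges v := by
  have key : ∀ e ∈ S.edges,
      localSpan G α S.edges (G.src e) ≤ localSpan G α S.edges (G.dst e) := fun e he =>
    localSpan_le hax hθ (hS.bar_mem he) fun e' h h' => hS.map_mem he h h'
  refine hS.induction_on (P := fun w => localSpan G α S.edges w = localSpan G α S.edges v)
    hv hw rfl fun e he h => ?_
  rw [← h]
  refine le_antisymm ?_ (key e he)
  have := key _ (hS.bar_mem he)
  rwa [G.src_bar, G.dst_bar] at this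

lemma IsFace.mem_edges_iff (hax : IsAxial G α) (hθ : IsConnection G α θ) {S : Subgr V E}
    (hS : IsFace G θ S) {v : V} (hv : v ∈ S.verts) {e : E} (he : G.src e ∈ S.verts) :
    e ∈ S.edges ↔ α e ∈ localSpan G α S.edges v := by
  rw [← hS.localSpan_eq hax hθ hv he, hax.mem_localSpan_iff rfl]

/-- A face with a vertex in common with another one is contained in it as soon as this holds
for the edges at that vertex. -/
lemma IsFace.le_of_local (hax : IsAxial G α) (hθ : IsConnection G α θ) {S T : Subgr V E}
    (hS : IsFace G θ S) (hT : IsFace G θ T) {v : V} (hvS : v ∈ S.verts) (hvT : v ∈ T.verts)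
    (h : ∀ e, G.src e = v → e ∈ S.edges → e ∈ T.edges) : Subgr.le S T := by
  have hle : localSpan G α S.edges v ≤ localSpan G α T.edges v :=
    Submodule.span_mono (Set.image_mono fun e he => ⟨he.1, h e he.1 he.2⟩)
  have hedge : ∀ e ∈ S.edges, G.src e ∈ T.verts → e ∈ T.edges := fun e he ht =>
    (hT.mem_edges_iff hax hθ hvT ht).2 (hle ((hS.mem_edges_iff hax hθ hvS (hS.src_mem he)).1 he))
  have hvert : S.verts ⊆ T.verts := fun w hw =>
    hS.induction_on hvS hw hvT fun e he ht => hT.dst_mem (hedge e he ht)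
  exact ⟨hvert, fun e he => hedge e he (hvert (hS.src_mem he))⟩

lemma Subgr.le_antisymm {S T : Subgr V E} (h : Subgr.le S T) (h' : Subgr.le T S) : S = T := by
  cases S; cases T
  simp only [Subgr.mk.injEq]
  exact ⟨h.1.antisymm h'.1, h.2.antisymm h'.2⟩

lemma IsFace.eq_of_local (hax : IsAxial G α) (hθ : IsConnection G α θ) {S T : Subgr V E}
    (hS : IsFace G θ S) (hT : IsFace G θ T) {v : V} (hvS : v ∈ S.verts) (hvT : v ∈ T.verts)
    (h : ∀ e, G.src e = v → (e ∈ S.edges ↔ e ∈ T.edges)) : S = T :=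
  Subgr.le_antisymm (hS.le_of_local hax hθ hT hvS hvT fun e he => (h e he).1)
    (hT.le_of_local hax hθ hS hvT hvS fun e he => (h e he).2)

/-- Any set of edges at a vertex spans a face. -/
lemma exists_face (hax : IsAxial G α) (hθ : IsConnection G α θ) (v : V) (A : Set E) :
    ∃ S : Subgr V E, IsFace G θ S ∧ v ∈ S.verts ∧ ∀ e, G.src e = v → (e ∈ S.edges ↔ e ∈ A) := by
  set W := localSpan G α A v with hW
  set B : Set E := {e | α e ∈ W} with hB
  set R : V → V → Prop := Relation.ReflTransGen (fun u w => ∃ e ∈ B, G.src e = u ∧ G.dst e = w)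
    with hR
  set S : Subgr V E := ⟨{w | R v w}, {e | e ∈ B ∧ R v (G.src e)}⟩ with hS
  have hBbar : ∀ e ∈ B, G.bar e ∈ B := fun e he => (hax.bar_mem_iff W e).2 he
  have hstep : ∀ e ∈ S.edges, R v (G.dst e) := fun e he =>
    he.2.tail ⟨e, he.1, rfl, rfl⟩
  have hSbar : ∀ e ∈ S.edges, G.bar e ∈ S.edges := fun e he =>
    ⟨hBbar e he.1, by rw [G.src_bar]; exact hstep e he⟩
  have hlocal : ∀ u, R v u → localSpan G α B u = W := by
    intro u hu
    refine le_antisymm (Submodule.span_le.2 ?_) ?_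
    · rintro _ ⟨e, ⟨-, he⟩, rfl⟩
      exact he
    induction hu with
    | refl =>
      refine Submodule.span_mono (Set.image_mono ?_)
      rintro e ⟨rfl, he⟩
      exact ⟨rfl, mem_localSpan he⟩
    | tail _ h ih =>
      obtain ⟨e, he, rfl, rfl⟩ := h
      exact ih.trans (localSpan_le hax hθ (hBbar e he) fun e' h h' =>
        (hθ.mem_iff (W := W) he h).2 h')
  have hreach : ∀ u, R v u → Reach G S v u := by
    intro u hu
    induction hu with
    | refl => exact .refl
    | tail h1 h ih =>
      obtain ⟨e, he, rfl, rfl⟩ := h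
      exact ih.tail ⟨e, ⟨he, h1⟩, rfl, rfl⟩
  have hsymm : ∀ u, Reach G S v u → Reach G S u v := by
    intro u hu
    induction hu with
    | refl => exact .refl
    | tail _ h ih =>
      obtain ⟨e, he, rfl, rfl⟩ := h
      exact ih.head ⟨G.bar e, hSbar e he, G.src_bar e, G.dst_bar e⟩
  refine ⟨S, ⟨⟨v, .refl⟩, fun e he => ⟨he.2, hstep e he⟩, hSbar, ⟨Module.finrank ℚ W, ?_⟩,
    fun u hu w hw => (hsymm u (hreach u hu)).trans (hreach w hw), ?_⟩, .refl, ?_⟩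
  · intro u hu
    have hli : LinearIndependent ℚ
        (fun e : {e : E // e ∈ S.edges ∧ G.src e = u} => α e.1) :=
      (hax.1 u).comp (fun e => ⟨e.1, e.2.2⟩) fun a b h => Subtype.ext (by simpa using h)
    have hfin := hli.finite
    have := Fintype.ofFinite {e : E // e ∈ S.edges ∧ G.src e = u}
    have hset : Set.range (fun e : {e : E // e ∈ S.edges ∧ G.src e = u} => α e.1) =
        α '' {e | G.src e = u ∧ e ∈ B} := by
      ext x
      constructor
      · rintro ⟨⟨e, he, he'⟩, rfl⟩
        exact ⟨e, ⟨he', he.1⟩, rfl⟩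
      · rintro ⟨e, ⟨rfl, he⟩, rfl⟩
        exact ⟨⟨e, ⟨he, hu⟩, rfl⟩, rfl⟩
    rw [Nat.card_eq_fintype_card, ← finrank_span_eq_card hli, hset, ← hlocal u hu]
    rfl
  · intro e he e' h he'
    refine ⟨(hθ.mem_iff (W := W) he.1 h).2 he'.1, ?_⟩
    rw [hθ.src_eq h]
    exact hstep e he
  · rintro e rfl
    refine ⟨fun h => (hax.mem_localSpan_iff rfl).1 h.1, fun h => ⟨mem_localSpan h, .refl⟩⟩

/-- A component of an intersection of two faces is a face. -/
lemma IsCompOf.isFace (hax : IsAxial G α) (hθ : IsConnection G α θ) {A B C : Subgr V E}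
    (hA : IsFace G θ A) (hB : IsFace G θ B) (hC : IsCompOf G C (Subgr.inter A B)) :
    IsFace G θ C ∧ ∀ e, G.src e ∈ C.verts → (e ∈ C.edges ↔ e ∈ A.edges ∧ e ∈ B.edges) := by
  obtain ⟨v, ⟨hvA, hvB⟩, hCv, hCe⟩ := hC
  obtain ⟨F, hF, hvF, hFe⟩ := exists_face hax hθ v (A.edges ∩ B.edges)
  have hFA := hF.le_of_local hax hθ hA hvF hvA fun e he h => ((hFe e he).1 h).1
  have hFB := hF.le_of_local hax hθ hB hvF hvB fun e he h => ((hFe e he).1 h).2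
  have hmem : ∀ w ∈ F.verts, ∀ e, G.src e = w → e ∈ A.edges → e ∈ B.edges → e ∈ F.edges := by
    intro w hw
    refine hF.induction_on
      (P := fun w => ∀ e, G.src e = w → e ∈ A.edges → e ∈ B.edges → e ∈ F.edges) hvF hw
      (fun e he h h' => (hFe e he).2 ⟨h, h'⟩) ?_
    intro f hf ih e he heA heB
    obtain ⟨e', he', rfl⟩ := (hθ.1 f).surjOn he
    have hback : ∀ {D : Subgr V E}, IsFace G θ D → f ∈ D.edges → θ f e' ∈ D.edges →
        e' ∈ D.edges := by
      intro D hD hfD h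
      have hs := hD.src_mem hfD
      have hs' : G.src e' ∈ D.verts := by
        rw [he']; exact hs
      rw [hD.mem_edges_iff hax hθ hs hs', ← hθ.mem_iff
        ((hD.mem_edges_iff hax hθ hs hs).1 hfD) he', ← hD.mem_edges_iff hax hθ hs]
      · exact h
      · rw [hθ.src_eq he']; exact hD.dst_mem hfD
    exact hF.map_mem hf he' (ih e' he' (hback hA (hFA.2 hf) heA) (hback hB (hFB.2 hf) heB))
  have hverts : C.verts = F.verts := by
    rw [hCv]
    ext w
    constructor
    · rintro ⟨-, h⟩
      unfold Reach at h
      induction h with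
      | refl => exact hvF
      | tail _ h ih =>
        obtain ⟨e, ⟨heA, heB⟩, rfl, rfl⟩ := h
        exact hF.dst_mem (hmem _ ih e rfl heA heB)
    · intro hw
      refine ⟨⟨hFA.1 hw, hFB.1 hw⟩, Relation.ReflTransGen.mono ?_ _ _ (hF.reach hvF hw)⟩
      rintro _ _ ⟨e, he, h⟩
      exact ⟨e, ⟨hFA.2 he, hFB.2 he⟩, h⟩
  have hedges : C.edges = F.edges := by
    rw [hCe, hverts]
    ext e
    constructor
    · rintro ⟨⟨heA, heB⟩, hs, -⟩
      exact hmem _ hs e rfl heA heB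
    · intro he
      exact ⟨⟨hFA.2 he, hFB.2 he⟩, hF.src_mem he, hF.dst_mem he⟩
  have hCF : C = F := by
    cases C; cases F
    simp only at hverts hedges
    rw [hverts, hedges]
  subst hCF
  exact ⟨hF, fun e hs => ⟨fun h => ⟨hFA.2 h, hFB.2 h⟩, fun h => hmem _ hs e rfl h.1 h.2⟩⟩

lemma IsFace.join_local (hax : IsAxial G α) (hθ : IsConnection G α θ)
    {join : Subgr V E → Subgr V E → Subgr V E} (hjoin : IsJoinFun G θ join) {A B : Subgr V E}
    (hA : IsFace G θ A) (hB : IsFace G θ B) {v : V} (hvA : v ∈ A.verts) (hvB : v ∈ B.verts)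
    {e : E} (he : G.src e = v) : e ∈ (join A B).edges ↔ e ∈ A.edges ∨ e ∈ B.edges := by
  obtain ⟨-, hAJ, hBJ, hmin⟩ := hjoin A B hA hB
  obtain ⟨F, hF, hvF, hFe⟩ := exists_face hax hθ v (A.edges ∪ B.edges)
  refine ⟨fun h => (hFe e he).1 ((hmin F hF ?_ ?_).2 h), fun h => h.elim (hAJ.2 ·) (hBJ.2 ·)⟩
  · exact hA.le_of_local hax hθ hF hvA hvF fun e he h => (hFe e he).2 (Or.inl h)
  · exact hB.le_of_local hax hθ hF hvB hvF fun e he h => (hFe e he).2 (Or.inr h)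

lemma IsCompOf.eq_of_mem (hax : IsAxial G α) (hθ : IsConnection G α θ) {A B C D : Subgr V E}
    (hA : IsFace G θ A) (hB : IsFace G θ B) (hC : IsCompOf G C (Subgr.inter A B))
    (hD : IsCompOf G D (Subgr.inter A B)) {v : V} (hvC : v ∈ C.verts) (hvD : v ∈ D.verts) :
    C = D := by
  obtain ⟨hCF, hC'⟩ := hC.isFace hax hθ hA hB
  obtain ⟨hDF, hD'⟩ := hD.isFace hax hθ hA hB
  refine hCF.eq_of_local hax hθ hDF hvC hvD fun e he => ?_
  subst he
  rw [hC' e hvC, hD' e hvD]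

lemma IsCompOf.verts_subset {C S : Subgr V E} (hC : IsCompOf G C S) : C.verts ⊆ S.verts := by
  obtain ⟨v, hv, h, -⟩ := hC
  rw [h]
  exact fun w hw => hw.1

lemma exists_isCompOf {S : Subgr V E} {v : V} (hv : v ∈ S.verts) :
    ∃ C, IsCompOf G C S ∧ v ∈ C.verts :=
  ⟨⟨{w ∈ S.verts | Reach G S v w}, {e ∈ S.edges | G.src e ∈ {w ∈ S.verts | Reach G S v w} ∧
    G.dst e ∈ {w ∈ S.verts | Reach G S v w}}⟩, ⟨v, hv, rfl, rfl⟩, hv, .refl⟩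

end Faces

end OT

namespace OT

section Algebra

variable {V E : Type} {n : ℕ} {G : OTGraph V E} {α : E → Fin n → ℚ} {θ : E → E → E}

/-- `linf` as a linear map. -/
def linfLM (n : ℕ) : (Fin n → ℚ) →ₗ[ℚ] MvPolynomial (Fin n) ℚ :=
  (Pi.basisFun ℚ (Fin n)).constr ℚ MvPolynomial.X

lemma linfLM_apply (a : Fin n → ℚ) : linfLM n a = linf a := by
  simp [linfLM, linf, Module.Basis.constr_apply_fintype, MvPolynomial.smul_eq_C_mul]

lemma linf_add_smul (a b : Fin n → ℚ) (q : ℚ) :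
    linf (a + q • b) = linf a + MvPolynomial.C q * linf b := by
  simp only [← linfLM_apply, map_add, map_smul, MvPolynomial.smul_eq_C_mul]

lemma linf_smul (b : Fin n → ℚ) (q : ℚ) : linf (q • b) = MvPolynomial.C q * linf b := by
  simp only [← linfLM_apply, map_smul, MvPolynomial.smul_eq_C_mul]

/-- The labels of the edges at a vertex are polynomial generators of `ℚ[t_1,…,t_n]`. -/
lemma exists_coordinates [Fintype E] (hn : 1 ≤ n) (hval : IsValent G n) (hax : IsAxial G α)
    (v : V) :
    ∃ ψ : MvPolynomial {e : E // G.src e = v} ℚ ≃ₐ[ℚ] MvPolynomial (Fin n) ℚ,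
      ∀ e, ψ (MvPolynomial.X e) = linf (α e.1) := by
  have hcard : Fintype.card {e : E // G.src e = v} = n := by
    rw [← Nat.card_eq_fintype_card]; exact hval v
  have : Nonempty {e : E // G.src e = v} := Fintype.card_pos_iff.1 (by omega)
  let b := basisOfLinearIndependentOfCardEqFinrank (hax.1 v) (by simp [hcard])
  refine ⟨(SymmetricAlgebra.equivMvPolynomial b).symm.trans
    (SymmetricAlgebra.equivMvPolynomial (Pi.basisFun ℚ (Fin n))), fun e => ?_⟩
  have hb : b e = α e.1 := by simp [b]
  rw [AlgEquiv.trans_apply, SymmetricAlgebra.equivMvPolynomial_symm_X, hb, ← linfLM_apply]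
  simp [SymmetricAlgebra.equivMvPolynomial, linfLM]

/-- The exponent vector of the Thom class of `S` at `v`. -/
def offEdges [Fintype E] (G : OTGraph V E) (v : V) (S : Subgr V E) :
    {e : E // G.src e = v} →₀ ℕ :=
  Finsupp.equivFunOnFinite.symm fun e => if e.1 ∈ S.edges then 0 else 1

lemma offEdges_apply [Fintype E] (v : V) (S : Subgr V E) (e : {e : E // G.src e = v}) :
    offEdges G v S e = if e.1 ∈ S.edges then 0 else 1 := rfl

lemma tau_of_notMem {S : Subgr V E} {v : V} (h : v ∉ S.verts) : tau G α S v = 0 := if_neg h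

lemma tau_of_mem [Fintype E] {S : Subgr V E} {v : V} (h : v ∈ S.verts) :
    tau G α S v = ∏ e : {e : E // G.src e = v}, linf (α e.1) ^ offEdges G v S e := by
  unfold tau
  rw [if_pos h]
  have : (∏ᶠ (e : E) (_ : G.src e = v ∧ e ∉ S.edges), linf (α e)) =
      ∏ e ∈ Finset.univ.filter (fun e => G.src e = v ∧ e ∉ S.edges), linf (α e) := by
    rw [← finprod_mem_coe_finset]
    simp
  rw [this, ← Finset.filter_filter, Finset.prod_filter,
    Finset.prod_subtype (p := fun e => G.src e = v) _ (by simp)]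
  refine Finset.prod_congr rfl fun e _ => ?_
  by_cases he : e.1 ∈ S.edges <;> simp [offEdges_apply, he]

lemma tau_eq_monomial [Fintype E] {v : V}
    {ψ : MvPolynomial {e : E // G.src e = v} ℚ ≃ₐ[ℚ] MvPolynomial (Fin n) ℚ}
    (hψ : ∀ e, ψ (MvPolynomial.X e) = linf (α e.1)) {S : Subgr V E} (h : v ∈ S.verts) :
    tau G α S v = ψ (MvPolynomial.monomial (offEdges G v S) 1) := by
  rw [tau_of_mem h, MvPolynomial.monomial_eq, map_one, one_mul, Finsupp.prod_fintype _ _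
    (fun _ => pow_zero _), map_prod]
  simp [hψ]

lemma mu_X (F : PFace G θ) : mu G α θ (MvPolynomial.X F) = tau G α F.1 := by
  simp [mu]

lemma mu_C (c : ℚ) : mu G α θ (MvPolynomial.C c) = fun _ => MvPolynomial.C c := by
  ext1 v
  simp [mu, Pi.constRingHom]
  rfl

lemma mu_xpoly [Fintype E] (hn : 1 ≤ n) (hval : IsValent G n) {S : Subgr V E} (hS : IsFace G θ S) :
    mu G α θ (xpoly G θ S) = tau G α S := by
  unfold xpoly
  rw [dif_pos hS]
  split_ifs with h
  · rw [map_one]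
    ext1 v
    have : Nonempty {e : E // G.src e = v} := by
      by_contra hne
      rw [not_nonempty_iff] at hne
      have := hval v
      rw [Nat.card_of_isEmpty] at this
      omega
    obtain ⟨e, rfl⟩ := this
    rw [tau_of_mem (hS.src_mem (e := e) (by simp [h]))]
    simp [offEdges_apply, h]
  · exact mu_X _

/-- The graph cohomology as a subring. -/
def HQSubring (G : OTGraph V E) (α : E → Fin n → ℚ) : Subring (V → MvPolynomial (Fin n) ℚ) where
  carrier := HQSet G α
  mul_mem' {f g} hf hg e := by
    have : (f * g) (G.src e) - (f * g) (G.dst e) =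
        (f (G.src e) - f (G.dst e)) * g (G.src e) + f (G.dst e) * (g (G.src e) - g (G.dst e)) := by
      simp only [Pi.mul_apply]; ring
    rw [this]
    exact dvd_add (dvd_mul_of_dvd_left (hf e) _) (dvd_mul_of_dvd_right (hg e) _)
  one_mem' e := by simp
  add_mem' {f g} hf hg e := by
    have : (f + g) (G.src e) - (f + g) (G.dst e) =
        (f (G.src e) - f (G.dst e)) + (g (G.src e) - g (G.dst e)) := by
      simp only [Pi.add_apply]; ring
    rw [this]
    exact dvd_add (hf e) (hg e)
  zero_mem' e := by simp
  neg_mem' {f} hf e := by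
    have : (-f) (G.src e) - (-f) (G.dst e) = -(f (G.src e) - f (G.dst e)) := by
      simp only [Pi.neg_apply]; ring
    rw [this]
    exact (hf e).neg_right

lemma linf_dvd_tau [Fintype E] {S : Subgr V E} {e : E} (he : e ∉ S.edges) :
    linf (α e) ∣ tau G α S (G.src e) := by
  by_cases h : G.src e ∈ S.verts
  · rw [tau_of_mem h]
    refine dvd_trans ?_ (Finset.dvd_prod_of_mem _ (Finset.mem_univ ⟨e, rfl⟩))
    simp [offEdges_apply, he]
  · rw [tau_of_notMem h]
    exact dvd_zero _

lemma IsFace.map_mem_iff (hax : IsAxial G α) (hθ : IsConnection G α θ) {S : Subgr V E}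
    (hS : IsFace G θ S) {e e' : E} (he : e ∈ S.edges) (h : G.src e' = G.src e) :
    θ e e' ∈ S.edges ↔ e' ∈ S.edges := by
  have hs := hS.src_mem he
  have h1 : G.src e' ∈ S.verts := by rwa [h]
  have h2 : G.src (θ e e') ∈ S.verts := by rw [hθ.src_eq h]; exact hS.dst_mem he
  rw [hS.mem_edges_iff hax hθ hs h1, hS.mem_edges_iff hax hθ hs h2, hθ.mem_iff
    ((hS.mem_edges_iff hax hθ hs hs).1 he) h]

lemma IsFace.tau_mem [Fintype E] (hax : IsAxial G α) (hθ : IsConnection G α θ) {S : Subgr V E}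
    (hS : IsFace G θ S) : tau G α S ∈ HQSubring G α := by
  intro e
  by_cases he : e ∈ S.edges
  · rw [tau_of_mem (hS.src_mem he), tau_of_mem (hS.dst_mem he)]
    let φ : {e' : E // G.src e' = G.src e} ≃ {e' : E // G.src e' = G.dst e} :=
      (hθ.1 e).equiv
    have hφ : ∀ e', (φ e').1 = θ e e'.1 := fun e' => rfl
    rw [← φ.prod_comp, ← Ideal.mem_span_singleton, ← Ideal.Quotient.eq, map_prod, map_prod]
    refine Finset.prod_congr rfl fun e' _ => ?_
    have hoff : offEdges G (G.dst e) S (φ e') = offEdges G (G.src e) S e' := by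
      simp only [offEdges_apply, hφ, hS.map_mem_iff hax hθ he e'.2]
    obtain ⟨q, hq⟩ := hθ.eq_add_smul e'.2
    rw [hoff, map_pow, map_pow, hφ, hq, linf_add_smul]
    congr 1
    rw [Ideal.Quotient.eq, Ideal.mem_span_singleton]
    exact ⟨-MvPolynomial.C q, by ring⟩
  · refine dvd_sub (linf_dvd_tau he) ?_
    have hb : G.bar e ∉ S.edges := fun h => he (hS.bar_mem_iff.1 h)
    have h1 := linf_dvd_tau (G := G) (α := α) hb
    rw [G.src_bar] at h1
    refine dvd_trans ?_ h1
    obtain ⟨q, hq⟩ := hax.bar_eq_smul (G.bar e)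
    rw [G.bar_bar] at hq
    have hq0 : q ≠ 0 := by
      rintro rfl
      exact (hax.1 (G.src e)).ne_zero ⟨e, rfl⟩ (by simp [hq])
    refine ⟨MvPolynomial.C q⁻¹, ?_⟩
    rw [hq, linf_smul, mul_right_comm, ← map_mul, mul_inv_cancel₀ hq0, map_one, one_mul]

lemma mu_mem [Fintype E] (hax : IsAxial G α) (hθ : IsConnection G α θ)
    (f : MvPolynomial (PFace G θ) ℚ) : mu G α θ f ∈ HQSubring G α := by
  induction f using MvPolynomial.induction_on with
  | C c =>
    rw [mu_C]
    intro e
    simp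
  | add f g hf hg => rw [map_add]; exact add_mem hf hg
  | mul_X f F hf =>
    rw [map_mul, mu_X]
    exact mul_mem hf (F.2.1.tau_mem hax hθ)

instance [Finite V] [Finite E] : Finite (Subgr V E) :=
  Finite.of_injective (fun S : Subgr V E => (S.verts, S.edges)) fun S T h => by
    cases S; cases T; simpa using h

instance [Finite V] [Finite E] : Finite (PFace G θ) :=
  inferInstanceAs (Finite {S : Subgr V E // IsFace G θ S ∧ S.edges ≠ Set.univ})

lemma relPoly_eq [Fintype V] [Fintype E] (join : Subgr V E → Subgr V E → Subgr V E)
    (A B : Subgr V E) : ∃ s : Finset (Subgr V E),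
      (∀ C, C ∈ s ↔ IsCompOf G C (Subgr.inter A B)) ∧
      relPoly G θ join A B =
        xpoly G θ A * xpoly G θ B - xpoly G θ (join A B) * ∑ C ∈ s, xpoly G θ C := by
  have hfin : {C | IsCompOf G C (Subgr.inter A B)}.Finite := Set.toFinite _
  refine ⟨hfin.toFinset, by simp, ?_⟩
  unfold relPoly
  congr 2
  exact finsum_mem_eq_finite_toFinset_sum _ hfin

lemma mu_relPoly [Fintype V] [Fintype E] (hn : 1 ≤ n) (hval : IsValent G n) (hax : IsAxial G α)
    (hθ : IsConnection G α θ) {join : Subgr V E → Subgr V E → Subgr V E}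
    (hjoin : IsJoinFun G θ join) {A B : Subgr V E} (hA : IsFace G θ A) (hB : IsFace G θ B) :
    mu G α θ (relPoly G θ join A B) = 0 := by
  obtain ⟨s, hs, hrel⟩ := relPoly_eq (G := G) (θ := θ) join A B
  obtain ⟨hJ, hAJ, -⟩ := hjoin A B hA hB
  rw [hrel, map_sub, map_mul, map_mul, map_sum, mu_xpoly hn hval hA, mu_xpoly hn hval hB,
    mu_xpoly hn hval hJ, Finset.sum_congr rfl fun C hC =>
    mu_xpoly hn hval (((hs C).1 hC).isFace hax hθ hA hB).1]
  ext1 v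
  simp only [Pi.sub_apply, Pi.mul_apply, Finset.sum_apply, Pi.zero_apply]
  by_cases hv : v ∈ A.verts ∧ v ∈ B.verts
  · obtain ⟨C, hC, hvC⟩ := exists_isCompOf (G := G) (S := Subgr.inter A B) hv
    rw [Finset.sum_eq_single_of_mem C ((hs C).2 hC) fun D hD hne => tau_of_notMem fun hvD =>
      hne (((hs D).1 hD).eq_of_mem hax hθ hA hB hC hvD hvC), tau_of_mem hv.1, tau_of_mem hv.2,
      tau_of_mem hvC, tau_of_mem (hAJ.1 hv.1), ← Finset.prod_mul_distrib,
      ← Finset.prod_mul_distrib, sub_eq_zero]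
    refine Finset.prod_congr rfl fun e _ => ?_
    rw [← pow_add, ← pow_add]
    congr 1
    have h1 := hA.join_local hax hθ hjoin hB hv.1 hv.2 e.2
    have h2 := (hC.isFace hax hθ hA hB).2 e.1 (by rw [e.2]; exact hvC)
    simp only [offEdges_apply, h1, h2]
    by_cases ha : e.1 ∈ A.edges <;> by_cases hb : e.1 ∈ B.edges <;> simp [ha, hb]
  · have h1 : tau G α A v * tau G α B v = 0 := by
      rw [not_and_or] at hv
      rcases hv with hv | hv <;> simp [tau_of_notMem hv]
    rw [h1, Finset.sum_eq_zero fun C hC => tau_of_notMem fun hvC =>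
      hv (((hs C).1 hC).verts_subset hvC)]
    simp

end Algebra

end OT

namespace OT

section Surjectivity

variable {V E : Type} {n : ℕ} {G : OTGraph V E} {α : E → Fin n → ℚ} {θ : E → E → E}

lemma IsFace.sub_mem_span (hax : IsAxial G α) (hθ : IsConnection G α θ) {F : Subgr V E}
    (hF : IsFace G θ F) {h : V → MvPolynomial (Fin n) ℚ} (hh : h ∈ HQSubring G α) {v w : V}
    (hv : v ∈ F.verts) (hw : w ∈ F.verts) :
    h v - h w ∈ Ideal.span (linf '' (α '' {e | G.src e = v ∧ e ∈ F.edges})) := by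
  set J := Ideal.span (linf '' (α '' {e | G.src e = v ∧ e ∈ F.edges})) with hJ
  have hle : localSpan G α F.edges v ≤ (J.restrictScalars ℚ).comap (linfLM n) := by
    refine Submodule.span_le.2 ?_
    intro a ha
    change linfLM n a ∈ J
    rw [linfLM_apply]
    exact Ideal.subset_span ⟨a, ha, rfl⟩
  refine hF.induction_on (P := fun u => h v - h u ∈ J) hv hw (by simp) fun e he hs => ?_
  have h1 : linf (α e) ∈ J := by
    rw [← linfLM_apply]
    exact hle ((hF.mem_edges_iff hax hθ hv (hF.src_mem he)).1 he)
  have h2 : h v - h (G.dst e) = (h v - h (G.src e)) + (h (G.src e) - h (G.dst e)) := by ring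
  rw [h2]
  exact J.add_mem hs (J.mem_of_dvd (hh e) h1)

/-- Every monomial in the labels at `v` is the value at `v` of a polynomial in the Thom classes
that is supported on the face spanned by the edges that do not occur in the monomial. -/
lemma exists_mu_eq_prod [Fintype E] (hn : 1 ≤ n) (hval : IsValent G n) (hax : IsAxial G α)
    (hθ : IsConnection G α θ) {v : V} {F : Subgr V E} (hF : IsFace G θ F) (hv : v ∈ F.verts)
    {a : {e : E // G.src e = v} →₀ ℕ} (ha : ∀ e, e.1 ∈ F.edges ↔ a e = 0) :
    ∃ f : MvPolynomial (PFace G θ) ℚ, mu G α θ f v = ∏ e, linf (α e.1) ^ a e ∧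
      ∀ w ∉ F.verts, mu G α θ f w = 0 := by
  choose K hK hvK hKe using fun e : {e : E // G.src e = v} =>
    exists_face hax hθ v {e' | e' ≠ e.1}
  refine ⟨xpoly G θ F * ∏ e, xpoly G θ (K e) ^ (a e - 1), ?_, fun w hw => ?_⟩
  · simp only [map_mul, map_prod, map_pow, Pi.mul_apply, Finset.prod_apply, Pi.pow_apply]
    rw [mu_xpoly hn hval hF, tau_of_mem hv, ← Finset.prod_mul_distrib]
    refine Finset.prod_congr rfl fun e _ => ?_
    have hKv : tau G α (K e) v = linf (α e.1) := by
      rw [tau_of_mem (hvK e), Finset.prod_eq_single_of_mem e (Finset.mem_univ e)]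
      · simp [offEdges_apply, hKe e e.1 e.2]
      · intro e' _ hne
        have : e'.1 ∈ (K e).edges := (hKe e e'.1 e'.2).2 fun h => hne (Subtype.ext h)
        simp [offEdges_apply, this]
    rw [mu_xpoly hn hval (hK e), hKv, ← pow_add, offEdges_apply, ha]
    congr 1
    split_ifs <;> omega
  · rw [map_mul, Pi.mul_apply, mu_xpoly hn hval hF, tau_of_notMem hw, zero_mul]

lemma exists_mu_eq [Fintype V] [Fintype E] (hn : 1 ≤ n) (hval : IsValent G n)
    (hax : IsAxial G α) (hθ : IsConnection G α θ) {h : V → MvPolynomial (Fin n) ℚ}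
    (hh : h ∈ HQSubring G α) : ∃ f : MvPolynomial (PFace G θ) ℚ, mu G α θ f = h := by
  suffices H : ∀ T : Finset V, ∃ f : MvPolynomial (PFace G θ) ℚ, ∀ v ∈ T, mu G α θ f v = h v by
    obtain ⟨f, hf⟩ := H Finset.univ
    exact ⟨f, funext fun v => hf v (Finset.mem_univ v)⟩
  intro T
  induction T using Finset.induction_on with
  | empty => exact ⟨0, by simp⟩
  | insert v T hvT ih =>
    obtain ⟨f, hf⟩ := ih
    have hg : h - mu G α θ f ∈ HQSubring G α := sub_mem hh (mu_mem hax hθ f)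
    have hgT : ∀ w ∈ T, (h - mu G α θ f) w = 0 := fun w hw => by simp [hf w hw]
    have hgv : (h - mu G α θ f) v = h v - mu G α θ f v := rfl
    set g := h - mu G α θ f
    obtain ⟨ψ, hψ⟩ := exists_coordinates hn hval hax v
    obtain ⟨q, hq⟩ := ψ.surjective (g v)
    have key : ∀ a ∈ q.support, ∃ f' : MvPolynomial (PFace G θ) ℚ,
        mu G α θ f' v = ∏ e, linf (α e.1) ^ a e ∧ ∀ w ∈ T, mu G α θ f' w = 0 := by
      intro a ha
      obtain ⟨F, hF, hvF, hFe⟩ := exists_face hax hθ v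
        {e | ∃ he : G.src e = v, a ⟨e, he⟩ = 0}
      have haF : ∀ e, e.1 ∈ F.edges ↔ a e = 0 := fun e => by
        rw [hFe e.1 e.2]
        exact ⟨fun ⟨_, h⟩ => h, fun h => ⟨e.2, h⟩⟩
      obtain ⟨f', hf'v, hf'⟩ := exists_mu_eq_prod hn hval hax hθ hF hvF haF
      refine ⟨f', hf'v, fun w hw => hf' w fun hwF => ?_⟩
      have h1 := hF.sub_mem_span hax hθ hg hvF hwF
      rw [hgT w hw, sub_zero, ← hq] at h1
      have h2 : q ∈ Ideal.span (MvPolynomial.X '' {e : {e : E // G.src e = v} | e.1 ∈ F.edges} :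
          Set (MvPolynomial {e : E // G.src e = v} ℚ)) := by
        have h3 := Ideal.mem_map_of_mem ψ.symm h1
        rw [AlgEquiv.symm_apply_apply, Ideal.map_span] at h3
        refine Ideal.span_mono ?_ h3
        rintro _ ⟨_, ⟨_, ⟨e, ⟨he, heF⟩, rfl⟩, rfl⟩, rfl⟩
        exact ⟨⟨e, he⟩, heF, by rw [← hψ ⟨e, he⟩, AlgEquiv.symm_apply_apply]⟩
      obtain ⟨e, he, hae⟩ := MvPolynomial.mem_ideal_span_X_image.1 h2 a ha
      exact hae ((haF e).1 he)
    choose! P hPv hPT using key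
    refine ⟨f + ∑ a ∈ q.support, MvPolynomial.C (q.coeff a) * P a, ?_⟩
    simp only [map_add, map_sum, map_mul, mu_C, Pi.add_apply, Finset.sum_apply, Pi.mul_apply]
    intro w hw
    rcases Finset.mem_insert.1 hw with rfl | hw
    · have h1 : g w = ∑ a ∈ q.support, MvPolynomial.C (q.coeff a) * mu G α θ (P a) w := by
        rw [← hq]
        conv_lhs => rw [q.as_sum, map_sum]
        refine Finset.sum_congr rfl fun a ha => ?_
        rw [hPv a ha, MvPolynomial.monomial_eq, map_mul, Finsupp.prod_fintype _ _
          (fun _ => pow_zero _), map_prod, ← MvPolynomial.algebraMap_eq, AlgEquiv.commutes]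
        simp [hψ]
      rw [← h1, hgv]
      ring
    · rw [Finset.sum_eq_zero fun a ha => by rw [hPT a ha w hw, mul_zero], add_zero, hf w hw]

end Surjectivity

section Kernel

variable {V E : Type} {n : ℕ} {G : OTGraph V E} {α : E → Fin n → ℚ} {θ : E → E → E}

/-- The exponents of monomials in the generators whose variables form a chain of faces. -/
def chainExponents (G : OTGraph V E) (θ : E → E → E) : Set (PFace G θ →₀ ℕ) :=
  {m | ∀ A ∈ m.support, ∀ B ∈ m.support, Subgr.le A.1 B.1 ∨ Subgr.le B.1 A.1}

/-- The dimension of a face: the number of its edges at any of its vertices. -/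
def fdim (G : OTGraph V E) (S : Subgr V E) : ℕ :=
  if h : S.verts.Nonempty then Nat.card {e : E // e ∈ S.edges ∧ G.src e = h.some} else 0

lemma IsFace.card_eq_fdim [Fintype E] {S : Subgr V E} (hS : IsFace G θ S) {v : V}
    (hv : v ∈ S.verts) :
    (Finset.univ.filter fun e => e ∈ S.edges ∧ G.src e = v).card = fdim G S := by
  obtain ⟨d, hd⟩ := hS.2.2.2.1
  rw [fdim, dif_pos hS.1, hd _ hS.1.some_mem, ← hd v hv, Nat.card_eq_fintype_card,
    Fintype.card_subtype]

/-- A concave function of the dimension that vanishes at `0` and `n`. -/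
def faceWeight (G : OTGraph V E) (n : ℕ) (S : Subgr V E) : ℕ := fdim G S * (n - fdim G S)

lemma faceWeight_join_add_lt [Fintype E] (hval : IsValent G n) (hax : IsAxial G α)
    (hθ : IsConnection G α θ) {join : Subgr V E → Subgr V E → Subgr V E}
    (hjoin : IsJoinFun G θ join) {A B C : Subgr V E} (hA : IsFace G θ A) (hB : IsFace G θ B)
    (hAB : ¬ Subgr.le A B) (hBA : ¬ Subgr.le B A) (hC : IsCompOf G C (Subgr.inter A B)) :
    faceWeight G n (join A B) + faceWeight G n C < faceWeight G n A + faceWeight G n B := by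
  obtain ⟨hCF, hCe⟩ := hC.isFace hax hθ hA hB
  obtain ⟨v, hvC⟩ := hCF.1
  obtain ⟨hvA, hvB⟩ := hC.verts_subset hvC
  obtain ⟨hJ, hAJ, -⟩ := hjoin A B hA hB
  have cA := hA.card_eq_fdim hvA
  have cB := hB.card_eq_fdim hvB
  have cC := hCF.card_eq_fdim hvC
  have cJ := hJ.card_eq_fdim (hAJ.1 hvA)
  set a := Finset.univ.filter fun e => e ∈ A.edges ∧ G.src e = v with ha
  set b := Finset.univ.filter fun e => e ∈ B.edges ∧ G.src e = v with hb
  have hc : (Finset.univ.filter fun e => e ∈ C.edges ∧ G.src e = v) = a ∩ b := by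
    ext e
    simp only [ha, hb, Finset.mem_filter, Finset.mem_univ, true_and, Finset.mem_inter]
    constructor
    · rintro ⟨h, rfl⟩
      obtain ⟨h1, h2⟩ := (hCe e hvC).1 h
      exact ⟨⟨h1, rfl⟩, h2, rfl⟩
    · rintro ⟨⟨h1, rfl⟩, h2, -⟩
      exact ⟨(hCe e hvC).2 ⟨h1, h2⟩, rfl⟩
  have hj : (Finset.univ.filter fun e => e ∈ (join A B).edges ∧ G.src e = v) = a ∪ b := by
    ext e
    simp only [ha, hb, Finset.mem_filter, Finset.mem_univ, true_and, Finset.mem_union]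
    rw [← or_and_right]
    exact and_congr_left fun h => hA.join_local hax hθ hjoin hB hvA hvB h
  have hJn : (a ∪ b).card ≤ n := by
    rw [← hval v, Nat.card_eq_fintype_card, Fintype.card_subtype, ← hj]
    exact Finset.card_le_card fun e => by simp +contextual
  rw [hc] at cC
  rw [hj] at cJ
  have hlt1 : (a ∩ b).card < a.card := by
    refine Finset.card_lt_card (Finset.inter_subset_left.ssubset_of_not_subset fun h => hAB ?_)
    refine hA.le_of_local hax hθ hB hvA hvB fun e he heA => ?_
    have := Finset.mem_inter.1 (h (show e ∈ a by simp [ha, he, heA]))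
    simpa [hb, he] using this.2
  have hlt2 : (a ∩ b).card < b.card := by
    refine Finset.card_lt_card (Finset.inter_subset_right.ssubset_of_not_subset fun h => hBA ?_)
    refine hB.le_of_local hax hθ hA hvB hvA fun e he heB => ?_
    have := Finset.mem_inter.1 (h (show e ∈ b by simp [hb, he, heB]))
    simpa [ha, he] using this.1
  have hsum := Finset.card_union_add_card_inter a b
  rw [cA, cC] at hlt1
  rw [cB, cC] at hlt2
  rw [cA, cB, cC, cJ] at hsum
  rw [cJ] at hJn
  unfold faceWeight
  obtain ⟨x, hx, hx0⟩ : ∃ x, fdim G A = fdim G C + x ∧ 0 < x :=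
    ⟨fdim G A - fdim G C, by omega, by omega⟩
  obtain ⟨y, hy, hy0⟩ : ∃ y, fdim G B = fdim G C + y ∧ 0 < y :=
    ⟨fdim G B - fdim G C, by omega, by omega⟩
  obtain ⟨z, hz⟩ : ∃ z, n = fdim G C + x + y + z := ⟨n - (fdim G C + x + y), by omega⟩
  have hj' : fdim G (join A B) = fdim G C + x + y := by omega
  have e1 : n - fdim G (join A B) = z := by omega
  have e2 : n - fdim G C = x + y + z := by omega
  have e3 : n - fdim G A = y + z := by omega
  have e4 : n - fdim G B = x + z := by omega
  rw [e1, e2, e3, e4, hj', hx, hy]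
  nlinarith [Nat.mul_pos hx0 hy0]

lemma IsFace.exists_xpoly_eq_monomial [Fintype E] (hval : IsValent G n) {S : Subgr V E}
    (hS : IsFace G θ S) :
    ∃ k : PFace G θ →₀ ℕ, xpoly G θ S = MvPolynomial.monomial k 1 ∧
      Finsupp.weight (fun F : PFace G θ => faceWeight G n F.1) k = faceWeight G n S := by
  unfold xpoly
  rw [dif_pos hS]
  split_ifs with h
  · refine ⟨0, rfl, ?_⟩
    obtain ⟨v, hv⟩ := hS.1
    have : fdim G S = n := by
      rw [← hS.card_eq_fdim hv, ← hval v, Nat.card_eq_fintype_card, Fintype.card_subtype]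
      simp [h]
    simp [faceWeight, this]
  · refine ⟨Finsupp.single ⟨S, hS, h⟩ 1, rfl, ?_⟩
    exact (Finsupp.weight_single _ (⟨S, hS, h⟩ : PFace G θ) 1).trans (one_smul ℕ _)

/-- Straightening: modulo the relations every monomial is a combination of chain monomials. -/
lemma monomial_mem_sup [Fintype V] [Fintype E] (hval : IsValent G n) (hax : IsAxial G α)
    (hθ : IsConnection G α θ) {join : Subgr V E → Subgr V E → Subgr V E}
    (hjoin : IsJoinFun G θ join) (m : PFace G θ →₀ ℕ) :
    MvPolynomial.monomial m (1 : ℚ) ∈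
      (Ideal.span (relSet G θ join)).restrictScalars ℚ ⊔
        MvPolynomial.restrictSupport ℚ (chainExponents G θ) := by
  induction hN : Finsupp.weight (fun F : PFace G θ => faceWeight G n F.1) m
    using Nat.strong_induction_on generalizing m with
  | _ N ih =>
  by_cases hm : m ∈ chainExponents G θ
  · exact Submodule.mem_sup_right ((MvPolynomial.monomial_mem_restrictSupport ℚ).2 (Or.inl hm))
  · simp only [chainExponents, Set.mem_ofPred_eq, not_forall, not_or] at hm
    obtain ⟨A, hA, B, hB, hAB, hBA⟩ := hm
    have hne : A ≠ B := by
      rintro rfl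
      exact hAB ⟨subset_rfl, subset_rfl⟩
    obtain ⟨m', rfl⟩ : ∃ m', m = Finsupp.single A 1 + Finsupp.single B 1 + m' := by
      refine ⟨m - (Finsupp.single A 1 + Finsupp.single B 1),
        (add_tsub_cancel_of_le fun F => ?_).symm⟩
      rw [Finsupp.mem_support_iff] at hA hB
      rw [Finsupp.add_apply, Finsupp.single_apply, Finsupp.single_apply]
      split_ifs with h1 h2 h2
      · exact absurd (h1.trans h2.symm) hne
      · subst h1; omega
      · subst h2; omega
      · omega
    have hxA : xpoly G θ A.1 = MvPolynomial.X A := by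
      rw [xpoly, dif_pos A.2.1, dif_neg A.2.2]
      rfl
    have hxB : xpoly G θ B.1 = MvPolynomial.X B := by
      rw [xpoly, dif_pos B.2.1, dif_neg B.2.2]
      rfl
    obtain ⟨s, hs, hrel⟩ := relPoly_eq (G := G) (θ := θ) join A.1 B.1
    have hdecomp : MvPolynomial.monomial (Finsupp.single A 1 + Finsupp.single B 1 + m') (1 : ℚ) =
        MvPolynomial.monomial m' 1 * relPoly G θ join A.1 B.1 +
          ∑ C ∈ s, xpoly G θ (join A.1 B.1) * xpoly G θ C * MvPolynomial.monomial m' 1 := by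
      rw [hrel, ← Finset.sum_mul, ← Finset.mul_sum, hxA, hxB, MvPolynomial.X, MvPolynomial.X,
        MvPolynomial.monomial_mul, mul_sub, MvPolynomial.monomial_mul, add_comm m']
      simp only [mul_one]
      ring
    rw [hdecomp]
    refine add_mem (Submodule.mem_sup_left ?_) (sum_mem fun C hC => ?_)
    · exact Ideal.mul_mem_left _ _ (Ideal.subset_span ⟨A.1, B.1, A.2.1, B.2.1, rfl⟩)
    · have hC := (hs C).1 hC
      obtain ⟨k, hk, hkw⟩ := (hjoin A.1 B.1 A.2.1 B.2.1).1.exists_xpoly_eq_monomial hval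
      obtain ⟨l, hl, hlw⟩ :=
        (hC.isFace hax hθ A.2.1 B.2.1).1.exists_xpoly_eq_monomial hval
      have hlt := faceWeight_join_add_lt hval hax hθ hjoin A.2.1 B.2.1 hAB hBA hC
      rw [hk, hl, MvPolynomial.monomial_mul, MvPolynomial.monomial_mul, mul_one, mul_one]
      refine ih _ ?_ _ rfl
      rw [← hN]
      simp only [map_add, Finsupp.weight_single, one_smul, hkw, hlw]
      omega

/-- The exponent at `v` of the value of a monomial in the Thom classes of faces through `v`. -/
def localExponent [Fintype E] (θ : E → E → E) (v : V) :
    (PFace G θ →₀ ℕ) →+ ({e : E // G.src e = v} →₀ ℕ) :=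
  Finsupp.weight fun F : PFace G θ => offEdges G v F.1

lemma localExponent_apply_eq_zero_iff [Fintype E] {v : V} (m : PFace G θ →₀ ℕ)
    (e : {e : E // G.src e = v}) :
    localExponent θ v m e = 0 ↔ ∀ F ∈ m.support, e.1 ∈ F.1.edges := by
  rw [localExponent, Finsupp.weight_apply, Finsupp.sum, Finsupp.finsetSum_apply,
    Finset.sum_eq_zero_iff]
  refine forall₂_congr fun F hF => ?_
  rw [Finsupp.mem_support_iff] at hF
  simp [offEdges_apply, hF]

lemma exists_least_of_mem_chainExponents [Finite V] [Finite E] {m : PFace G θ →₀ ℕ}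
    (hm : m ∈ chainExponents G θ) (h0 : m ≠ 0) :
    ∃ F ∈ m.support, ∀ F' ∈ m.support, Subgr.le F.1 F'.1 := by
  obtain ⟨F, hF, hmin⟩ := Finset.exists_min_image m.support
    (fun F => F.1.verts.ncard + F.1.edges.ncard) (Finsupp.support_nonempty_iff.2 h0)
  refine ⟨F, hF, fun F' hF' => ?_⟩
  rcases hm F hF F' hF' with h | h
  · exact h
  · have h1 := Set.ncard_le_ncard h.1
    have h2 := Set.ncard_le_ncard h.2
    have h3 : F.1.verts.ncard + F.1.edges.ncard ≤ F'.1.verts.ncard + F'.1.edges.ncard :=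
      hmin F' hF'
    exact ⟨(Set.eq_of_subset_of_ncard_le h.1 (by omega)).symm.subset,
      (Set.eq_of_subset_of_ncard_le h.2 (by omega)).symm.subset⟩

lemma localExponent_injOn [Fintype V] [Fintype E] (hax : IsAxial G α) (hθ : IsConnection G α θ)
    (htop : IsFace G θ ⟨Set.univ, Set.univ⟩) (v : V) :
    Set.InjOn (localExponent (G := G) θ v)
      {m | m ∈ chainExponents G θ ∧ ∀ F ∈ m.support, v ∈ F.1.verts} := by
  have hzero : ∀ m : PFace G θ →₀ ℕ, (∀ F ∈ m.support, v ∈ F.1.verts) →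
      localExponent θ v m = 0 → m = 0 := by
    intro m hm h
    by_contra hne
    obtain ⟨F, hF⟩ := Finsupp.support_nonempty_iff.2 hne
    refine F.2.2 (Set.univ_subset_iff.1 (htop.le_of_local hax hθ F.2.1 (Set.mem_univ v) (hm F hF)
      fun e he _ => ?_).2)
    exact (localExponent_apply_eq_zero_iff m ⟨e, he⟩).1 (by rw [h]; rfl) F hF
  intro m hm m' hm' h
  induction hN : m.degree generalizing m m' with
  | zero =>
    rw [Finsupp.degree_eq_zero_iff] at hN
    rw [hN, map_zero] at h
    rw [hN, hzero m' hm'.2 h.symm]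
  | succ N ih =>
    have hm0 : m ≠ 0 := by
      rintro rfl
      simp at hN
    have hm0' : m' ≠ 0 := by
      rintro rfl
      rw [map_zero] at h
      exact hm0 (hzero m hm.2 h)
    obtain ⟨F, hF, hFle⟩ := exists_least_of_mem_chainExponents hm.1 hm0
    obtain ⟨F', hF', hFle'⟩ := exists_least_of_mem_chainExponents hm'.1 hm0'
    have hFF' : F = F' := by
      refine Subtype.ext (F.2.1.eq_of_local hax hθ F'.2.1 (hm.2 F hF) (hm'.2 F' hF')
        fun e he => ?_)
      have h1 := localExponent_apply_eq_zero_iff m ⟨e, he⟩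
      have h2 := localExponent_apply_eq_zero_iff m' ⟨e, he⟩
      rw [h] at h1
      have h3 := h1.symm.trans h2
      exact ⟨fun heF => h3.1 (fun D hD => (hFle D hD).2 heF) F' hF',
        fun heF => h3.2 (fun D hD => (hFle' D hD).2 heF) F hF⟩
    subst hFF'
    have hsplit : ∀ k : PFace G θ →₀ ℕ, F ∈ k.support → ∃ k', k = Finsupp.single F 1 + k' := by
      intro k hk
      refine ⟨k - Finsupp.single F 1, (add_tsub_cancel_of_le ?_).symm⟩
      rw [Finsupp.single_le_iff]
      exact Nat.one_le_iff_ne_zero.2 (Finsupp.mem_support_iff.1 hk)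
    obtain ⟨k, rfl⟩ := hsplit m hF
    obtain ⟨k', rfl⟩ := hsplit m' hF'
    have hsub : ∀ k : PFace G θ →₀ ℕ, k.support ⊆ (Finsupp.single F 1 + k).support := by
      intro k D hD
      rw [Finsupp.mem_support_iff] at hD ⊢
      rw [Finsupp.add_apply]
      omega
    have hmem : ∀ k : PFace G θ →₀ ℕ,
        Finsupp.single F 1 + k ∈ {m | m ∈ chainExponents G θ ∧ ∀ F ∈ m.support, v ∈ F.1.verts} →
        k ∈ {m | m ∈ chainExponents G θ ∧ ∀ F ∈ m.support, v ∈ F.1.verts} := fun k hk =>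
      ⟨fun D hD D' hD' => hk.1 D (hsub k hD) D' (hsub k hD'), fun D hD => hk.2 D (hsub k hD)⟩
    rw [map_add, map_add, add_right_inj] at h
    rw [map_add, Finsupp.degree_single] at hN
    rw [ih (hmem k hm) (hmem k' hm') h (by omega)]

lemma mu_apply_eq [Fintype E] {v : V}
    {ψ : MvPolynomial {e : E // G.src e = v} ℚ ≃ₐ[ℚ] MvPolynomial (Fin n) ℚ}
    (hψ : ∀ e, ψ (MvPolynomial.X e) = linf (α e.1)) (f : MvPolynomial (PFace G θ) ℚ) :
    mu G α θ f v = ψ (MvPolynomial.aeval (fun F : PFace G θ =>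
      if v ∈ F.1.verts then MvPolynomial.monomial (offEdges G v F.1) (1 : ℚ) else 0) f) := by
  induction f using MvPolynomial.induction_on with
  | C c => rw [mu_C, MvPolynomial.algHom_C, AlgEquiv.commutes, MvPolynomial.algebraMap_eq]
  | add f g hf hg => rw [map_add, Pi.add_apply, hf, hg, map_add, map_add]
  | mul_X f F hf =>
    rw [map_mul, Pi.mul_apply, hf, map_mul, map_mul, mu_X, MvPolynomial.aeval_X]
    split_ifs with h
    · rw [tau_eq_monomial hψ h]
    · rw [tau_of_notMem h, map_zero]

lemma eq_zero_of_mu_eq_zero [Fintype V] [Fintype E] (hn : 1 ≤ n) (hval : IsValent G n)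
    (hax : IsAxial G α) (hθ : IsConnection G α θ) (htop : IsFace G θ ⟨Set.univ, Set.univ⟩)
    {f : MvPolynomial (PFace G θ) ℚ}
    (hf : f ∈ MvPolynomial.restrictSupport ℚ (chainExponents G θ)) (h : mu G α θ f = 0) :
    f = 0 := by
  by_contra hne
  obtain ⟨m, hm⟩ := MvPolynomial.support_nonempty.2 hne
  rw [MvPolynomial.mem_restrictSupport_iff] at hf
  obtain ⟨v, hv⟩ : ∃ v, ∀ F ∈ m.support, v ∈ F.1.verts := by
    by_cases h0 : m = 0
    · obtain ⟨v, -⟩ := htop.1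
      exact ⟨v, by simp [h0]⟩
    · obtain ⟨F, -, hF⟩ := exists_least_of_mem_chainExponents (hf hm) h0
      obtain ⟨v, hv⟩ := F.2.1.1
      exact ⟨v, fun F' hF' => (hF F' hF').1 hv⟩
  obtain ⟨ψ, hψ⟩ := exists_coordinates hn hval hax v
  have h1 := mu_apply_eq hψ f
  rw [h, Pi.zero_apply, eq_comm, EmbeddingLike.map_eq_zero_iff, MvPolynomial.aeval_def,
    MvPolynomial.eval₂_eq] at h1
  have hprod : ∀ k : PFace G θ →₀ ℕ, ∏ F ∈ k.support, (if v ∈ F.1.verts then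
      MvPolynomial.monomial (offEdges G v F.1) (1 : ℚ) else 0) ^ k F =
      if ∀ F ∈ k.support, v ∈ F.1.verts then MvPolynomial.monomial (localExponent θ v k) 1
      else 0 := by
    intro k
    split_ifs with hk
    · rw [localExponent, Finsupp.weight_apply, Finsupp.sum, MvPolynomial.monomial_sum_one]
      refine Finset.prod_congr rfl fun F hF => ?_
      rw [if_pos (hk F hF), MvPolynomial.monomial_pow, one_pow]
    · push Not at hk
      obtain ⟨F, hF, hvF⟩ := hk
      refine Finset.prod_eq_zero hF ?_
      rw [if_neg hvF, zero_pow (Finsupp.mem_support_iff.1 hF)]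
  have h2 := congrArg (MvPolynomial.coeff (localExponent θ v m)) h1
  simp only [hprod] at h2
  rw [MvPolynomial.coeff_sum, MvPolynomial.coeff_zero, Finset.sum_eq_single_of_mem m hm] at h2
  · rw [if_pos hv, MvPolynomial.algebraMap_eq, MvPolynomial.coeff_C_mul,
      MvPolynomial.coeff_monomial, if_pos rfl, mul_one] at h2
    exact MvPolynomial.mem_support_iff.1 hm h2
  · intro k hk hkm
    rw [MvPolynomial.algebraMap_eq, MvPolynomial.coeff_C_mul]
    split_ifs with hvk
    · rw [MvPolynomial.coeff_monomial, if_neg, mul_zero]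
      exact fun heq => hkm (localExponent_injOn hax hθ htop v ⟨hf hk, hvk⟩ ⟨hf hm, hv⟩ heq)
    · simp

lemma ker_mu_eq [Fintype V] [Fintype E] (hn : 1 ≤ n) (hval : IsValent G n) (hax : IsAxial G α)
    (hθ : IsConnection G α θ) (htop : IsFace G θ ⟨Set.univ, Set.univ⟩)
    {join : Subgr V E → Subgr V E → Subgr V E} (hjoin : IsJoinFun G θ join) :
    RingHom.ker (mu G α θ) = Ideal.span (relSet G θ join) := by
  have hle : Ideal.span (relSet G θ join) ≤ RingHom.ker (mu G α θ) := by
    refine Ideal.span_le.2 ?_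
    rintro _ ⟨A, B, hA, hB, rfl⟩
    exact mu_relPoly hn hval hax hθ hjoin hA hB
  refine le_antisymm (fun f hf => ?_) hle
  have hsup : f ∈ (Ideal.span (relSet G θ join)).restrictScalars ℚ ⊔
      MvPolynomial.restrictSupport ℚ (chainExponents G θ) := by
    rw [f.as_sum]
    refine sum_mem fun m _ => ?_
    rw [← mul_one (MvPolynomial.coeff m f), ← smul_eq_mul, ← MvPolynomial.smul_monomial]
    exact Submodule.smul_mem _ _ (monomial_mem_sup hval hax hθ hjoin m)
  obtain ⟨i, hi, c, hc, rfl⟩ := Submodule.mem_sup.1 hsup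
  have hi' : mu G α θ i = 0 := hle hi
  have hc0 : c = 0 := by
    refine eq_zero_of_mu_eq_zero hn hval hax hθ htop hc ?_
    rwa [RingHom.mem_ker, map_add, hi', zero_add] at hf
  rw [hc0, add_zero]
  exact hi

end Kernel

end OT


open OT in
/-- `μ` induces a ring isomorphism `ℚ[x_F | F ∈ 𝓕]/ℐ_ℚ ≅ H^*_T(Γ,α;ℚ)`:
`μ` takes values in `H^*_T(Γ,α;ℚ)`, maps onto it, and its kernel is the ideal `ℐ_ℚ`
generated by the relations `x_E x_F − x_{E∨F} Σ_G x_G`. -/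
theorem rational_face_ring_iso_rational_equivariant_cohomology
    {V E : Type} [Fintype V] [Fintype E] {n : ℕ} (hn : 1 ≤ n)
    (G : OTGraph V E) (hval : IsValent G n)
    (α : E → Fin n → ℚ) (hax : IsAxial G α)
    (θ : E → E → E) (hθ : IsConnection G α θ)
    (htop : IsFace G θ ⟨Set.univ, Set.univ⟩)
    (join : Subgr V E → Subgr V E → Subgr V E) (hjoin : IsJoinFun G θ join) :
    (∀ f : MvPolynomial (PFace G θ) ℚ, mu G α θ f ∈ HQSet G α) ∧
    (∀ h ∈ HQSet G α, ∃ f : MvPolynomial (PFace G θ) ℚ, mu G α θ f = h) ∧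
    RingHom.ker (mu G α θ) = Ideal.span (relSet G θ join) := by
  exact ⟨mu_mem hax hθ, fun h hh => exists_mu_eq hn hval hax hθ hh,
    ker_mu_eq hn hval hax hθ htop hjoin⟩
end
end

section
/- An orbifold torus graph (Γ,α) admits at most one connection: if θ and θ' are both connections on (Γ,α), then θ_e = θ'_e for every oriented edge e of Γ. -/
open scoped Classical

noncomputable section

namespace OT

/-- The axial function on an edge is a rational multiple of its value on the reversed edge. -/
theorem IsAxial.mem_span_bar {V E : Type} {n : ℕ} {G : OTGraph V E} {α : E → Fin n → ℚ}
    (hax : IsAxial G α) (e : E) : α e ∈ Submodule.span ℚ {α (G.bar e)} := by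
  obtain ⟨r, r', hr, -, -, h⟩ := hax.2 e
  have hr0 : (r : ℚ) ≠ 0 := by positivity
  have hmem : (r : ℚ) • α e ∈ Submodule.span ℚ {α (G.bar e)} := by
    have hb := Submodule.smul_mem _ (r' : ℚ)
      (Submodule.mem_span_singleton_self (R := ℚ) (α (G.bar e)))
    rcases h with h | h <;> rw [h]
    · exact hb
    · exact neg_mem hb
  exact (Submodule.smul_mem_iff _ hr0).1 hmem

/-- Transport along `e` changes the axial function only in the direction of `α ē`. -/
theorem IsConnection.sub_mem_span_bar {V E : Type} {n : ℕ} {G : OTGraph V E}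
    {α : E → Fin n → ℚ} {θ : E → E → E} (hθ : IsConnection G α θ) (hax : IsAxial G α)
    {e e' : E} (he' : G.src e' = G.src e) :
    α (θ e e') - α e' ∈ Submodule.span ℚ {α (G.bar e)} := by
  obtain ⟨c, hc, z, h⟩ := hθ.2.2 e e' he'
  have hc0 : (c : ℚ) ≠ 0 := Int.cast_ne_zero.2 hc
  rw [← Submodule.smul_mem_iff _ hc0, h]
  exact Submodule.smul_mem _ _ (hax.mem_span_bar e)

end OT

open OT in
/-- an orbifold torus graph admits at most one connection. -/
theorem connection_unique
    {V E : Type} [Fintype V] [Fintype E] {n : ℕ} (hn : 1 ≤ n)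
    (G : OTGraph V E) (hval : IsValent G n)
    (α : E → Fin n → ℚ) (hax : IsAxial G α)
    (θ θ' : E → E → E) (hθ : IsConnection G α θ) (hθ' : IsConnection G α θ') :
    ∀ e e' : E, G.src e' = G.src e → θ e e' = θ' e e' := by
  intro e e' he'
  by_cases hee : e' = e
  · rw [hee, hθ.2.1, hθ'.2.1]
  by_contra hne
  have hf : G.src (θ e e') = G.dst e := (hθ.1 e).mapsTo he'
  have hf' : G.src (θ' e e') = G.dst e := (hθ'.1 e).mapsTo he'
  have hbar : θ e e' ≠ G.bar e := fun h =>
    hee ((hθ.1 e).injOn he' rfl (h.trans (hθ.2.1 e).symm))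
  have hmem : α (θ e e') ∈ Submodule.span ℚ {α (θ' e e'), α (G.bar e)} := by
    have h := sub_mem (hθ.sub_mem_span_bar hax he') (hθ'.sub_mem_span_bar hax he')
    rw [sub_sub_sub_cancel_right] at h
    have h' := Submodule.span_mono (Set.subset_insert (α (θ' e e')) _) h
    simpa using add_mem h' (Submodule.subset_span (Set.mem_insert (α (θ' e e')) _))
  refine (hax.1 (G.dst e)).notMem_span_image
    (s := {⟨θ' e e', hf'⟩, ⟨G.bar e, G.src_bar e⟩}) (x := ⟨θ e e', hf⟩) ?_ ?_
  · simp [hne, hbar]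
  · simpa [Set.image_pair] using hmem
end
end

section
/- Let (Γ,α) be an orbifold torus graph admitting a connection, equipped with facet data (𝓕^{(1)}, λ) as described. For an (n−1)-dimensional face F ∈ 𝓕^{(1)}, let ℓ_F be the least common multiple of the numbers |det Λ_v| over all vertices v of F. Then ℓ_F·x_F belongs to 𝒵_{Γ,α}; that is, ℓ_F·τ_F(v) ∈ ℤ[t_1,…,t_n] for every vertex v of Γ. -/
open scoped Classical

noncomputable section

namespace OT

theorem isIntPoly_C_mul_linf {n : ℕ} {c : ℚ} {a : Fin n → ℚ} (h : IsIntVec (c • a)) :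
    IsIntPoly (MvPolynomial.C c * linf a) := by
  choose z hz using h
  have key : MvPolynomial.C c * linf a = MvPolynomial.map (Int.castRingHom ℚ)
      (∑ j, MvPolynomial.C (z j) * MvPolynomial.X j) := by
    simp only [linf, Finset.mul_sum, map_sum, map_mul, MvPolynomial.map_C, MvPolynomial.map_X]
    refine Finset.sum_congr rfl fun j _ => ?_
    rw [← mul_assoc, ← map_mul, eq_intCast, ← hz j, Pi.smul_apply, smul_eq_mul]
  intro k
  rw [key, MvPolynomial.coeff_map]
  exact ⟨_, rfl⟩

/-- The rows of a rational left inverse of an integer matrix `M` become integral after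
multiplication by any multiple of `det M`. -/
theorem isIntVec_smul_row_of_mul_eq_one {n : ℕ} {A : Matrix (Fin n) (Fin n) ℚ}
    {M : Matrix (Fin n) (Fin n) ℤ} (hA : A * M.map (Int.castRingHom ℚ) = 1)
    {d : ℕ} (hd : M.det.natAbs ∣ d) (l : Fin n) : IsIntVec ((d : ℚ) • A l) := by
  obtain ⟨c, hc⟩ := Int.natAbs_dvd.mp (Int.natCast_dvd_natCast.mpr hd)
  have hadj : (M.det : ℚ) • A = M.adjugate.map (Int.castRingHom ℚ) := by
    have hmul : M.map (Int.castRingHom ℚ) * M.adjugate.map (Int.castRingHom ℚ)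
        = (M.det : ℚ) • (1 : Matrix (Fin n) (Fin n) ℚ) := by
      rw [← Matrix.map_mul, Matrix.mul_adjugate]
      ext i j
      simp only [Matrix.map_apply, Matrix.smul_apply, Matrix.one_apply, smul_eq_mul, map_mul,
        eq_intCast]
      split_ifs <;> simp
    calc
      (M.det : ℚ) • A
        = A * (M.map (Int.castRingHom ℚ) * M.adjugate.map (Int.castRingHom ℚ)) := by
          rw [hmul, Matrix.mul_smul, mul_one]
      _ = _ := by rw [← mul_assoc, hA, one_mul]
  intro j
  refine ⟨c * M.adjugate l j, ?_⟩
  have hlj := congrFun (congrFun hadj l) j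
  simp only [Matrix.smul_apply, Matrix.map_apply, smul_eq_mul, eq_intCast] at hlj
  have hdq : (d : ℚ) = M.det * c := by exact_mod_cast hc
  rw [Pi.smul_apply, smul_eq_mul, hdq, Int.cast_mul, ← hlj]
  ring

/-- If `e₀` is the only edge at `v` outside `S`, the Thom class of `S` at `v` is `α e₀`. -/
theorem tau_eq_linf {V E : Type} {n : ℕ} {G : OTGraph V E} {α : E → Fin n → ℚ}
    {S : Subgr V E} {v : V} (hv : v ∈ S.verts) {e₀ : E}
    (h : ∀ e, G.src e = v ∧ e ∉ S.edges ↔ e = e₀) : tau G α S v = linf (α e₀) := by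
  rw [tau, if_pos hv]
  simp only [h, finprod_cond_eq_left]

end OT

open OT in
/-- for a facet `F = facets s` of an orbifold torus graph with facet data
`(𝓕^{(1)}, λ)`, the integer `ℓ_F = lcm { |det Λ_v| : v ∈ V(F) }` clears all denominators:
`ℓ_F · x_F ∈ 𝒵_{Γ,α}`, i.e. `ℓ_F · τ_F(v)` has integer coefficients for every vertex. -/
theorem lcm_multiple_of_facet_thom_class_is_integral
    {V E : Type} [Fintype V] [Fintype E] {n m : ℕ} (hn : 1 ≤ n) (hm : 1 ≤ m)
    (G : OTGraph V E) (hval : IsValent G n)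
    (α : E → Fin n → ℚ) (hax : IsAxial G α)
    (θ : E → E → E) (hθ : IsConnection G α θ)
    (facets : Fin m → Subgr V E)
    (hface : ∀ j, IsFace G θ (facets j))
    (hfdim : ∀ j, ∀ v ∈ (facets j).verts,
      Nat.card {e : E // e ∈ (facets j).edges ∧ G.src e = v} = n - 1)
    (K : V → Fin n → Fin m) (Evec : V → Fin n → E)
    (hKinj : ∀ v : V, Function.Injective (K v))
    (hKmem : ∀ (v : V) (ℓ : Fin n), v ∈ (facets (K v ℓ)).verts)
    (hKall : ∀ (v : V) (j : Fin m), v ∈ (facets j).verts → ∃ ℓ, K v ℓ = j)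
    (hEsrc : ∀ (v : V) (ℓ : Fin n), G.src (Evec v ℓ) = v)
    (hEinj : ∀ v : V, Function.Injective (Evec v))
    (hEall : ∀ (v : V) (e : E), G.src e = v → ∃ ℓ, Evec v ℓ = e)
    (hEmem : ∀ (v : V) (ℓ j : Fin n), Evec v ℓ ∈ (facets (K v j)).edges ↔ j ≠ ℓ)
    (lam : Fin m → Fin n → ℤ)
    (hdual : ∀ (v : V) (ℓ j : Fin n),
      ∑ i, α (Evec v ℓ) i * (lam (K v j) i : ℚ) = if ℓ = j then 1 else 0)
    (Lam : V → Matrix (Fin n) (Fin n) ℤ)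
    (hLam : ∀ v : V, Lam v = Matrix.of fun i j => lam (K v j) i)
    (s : Fin m) (lF : ℕ)
    (hlF : lF = ((Set.toFinite (facets s).verts).toFinset).lcm fun v => (Lam v).det.natAbs) :
    ∀ v : V, IsIntPoly (MvPolynomial.C (lF : ℚ) * tau G α (facets s) v) := by
  intro v
  by_cases hv : v ∈ (facets s).verts
  · obtain ⟨l, rfl⟩ := hKall v s hv
    have hout : ∀ e, G.src e = v ∧ e ∉ (facets (K v l)).edges ↔ e = Evec v l := by
      intro e
      constructor
      · rintro ⟨he, hmem⟩
        obtain ⟨k, rfl⟩ := hEall v e he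
        rw [hEmem, not_not] at hmem
        rw [hmem]
      · rintro rfl
        exact ⟨hEsrc v l, by simp [hEmem]⟩
    rw [tau_eq_linf hv hout]
    have hinv : (Matrix.of fun k i => α (Evec v k) i) * (Lam v).map (Int.castRingHom ℚ) = 1 := by
      ext k j
      simpa [Matrix.mul_apply, hLam, Matrix.one_apply] using hdual v k j
    have hdvd : (Lam v).det.natAbs ∣ lF := by
      rw [hlF]
      exact Finset.dvd_lcm (f := fun v => (Lam v).det.natAbs) (by simpa using hv)
    exact isIntPoly_C_mul_linf (isIntVec_smul_row_of_mul_eq_one hinv hdvd l)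
  · intro k
    exact ⟨0, by simp [tau, hv]⟩
end
end
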